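/- arXiv:1708.01963 — 3 statements merged into one kernel-verified Lean document; each statement's English description precedes it below -/
import Mathlib

section
/- Let k be an algebraically closed field of characteristic ≠ 2 and let J be a Jordan superalgebra over k with dim J₀ = 1 and dim J₁ = 1. Then J is isomorphic, as a ℤ/2-graded algebra, to exactly one of the following four superalgebras on a basis {e₁; o₁} with e₁ even and o₁ odd (unlisted products being zero): (i) S₂²: e₁² = e₁, e₁o₁ = o₁; (ii) S₁²: e₁² = e₁, e₁o₁ = (1/2)o₁; (iii) e₁² = e₁, e₁o₁ = 0; (iv) all products zero. -/
/-- The sign `(-1)^{|a||b|}` as an element of the field `K`. -/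
def sgn (K : Type*) [Field K] (x y : Bool) : K := if x && y then -1 else 1

/-- A Jordan superalgebra over a field `K`: a `K`-vector space with a bilinear
multiplication, a `ℤ/2`-grading `J = J0 ⊕ J1`, super-commutativity and the super
Jordan identity on homogeneous elements. Parity `false` = even, `true` = odd. -/
structure JordanSuperalgebra (K : Type*) [Field K] (J : Type*) [AddCommGroup J]
    [Module K J] where
  mul : J →ₗ[K] J →ₗ[K] J
  J0 : Submodule K J
  J1 : Submodule K J
  compl : IsCompl J0 J1
  grade : ∀ pa pb : Bool, ∀ a ∈ cond pa J1 J0, ∀ b ∈ cond pb J1 J0,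
    mul a b ∈ cond (xor pa pb) J1 J0
  supercomm : ∀ pa pb : Bool, ∀ a ∈ cond pa J1 J0, ∀ b ∈ cond pb J1 J0,
    mul a b = sgn K pa pb • mul b a
  superJordan : ∀ pa pb pc pd : Bool,
    ∀ a ∈ cond pa J1 J0, ∀ b ∈ cond pb J1 J0, ∀ c ∈ cond pc J1 J0, ∀ d ∈ cond pd J1 J0,
    mul (mul a b) (mul c d) + sgn K pb pc • mul (mul a c) (mul b d)
        + (sgn K pb pd * sgn K pc pd) • mul (mul a d) (mul b c)
      = mul (mul (mul a b) c) d + (sgn K pc pd * sgn K pb pc) • mul (mul (mul a d) c) b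
        + (sgn K pa pb * sgn K pa pc * sgn K pa pd * sgn K pc pd) • mul (mul (mul b d) c) a

namespace JordanSuperalgebra

variable {K : Type*} [Field K] {J : Type*} [AddCommGroup J] [Module K J]

/-- An odd element squares to zero in characteristic different from two. -/
theorem mul_self_odd (h2 : (2 : K) ≠ 0) (S : JordanSuperalgebra K J) {o : J} (ho : o ∈ S.J1) :
    S.mul o o = 0 := by
  have h := S.supercomm true true o ho o ho
  simp only [sgn, Bool.and_self, if_true, neg_smul, one_smul] at h
  have h' : (2 : K) • S.mul o o = 0 := by
    rw [two_smul]
    nth_rewrite 1 [h]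
    exact neg_add_cancel _
  exact (smul_eq_zero.mp h').resolve_left h2

/-- An even and an odd element commute. -/
theorem mul_comm_odd_even (S : JordanSuperalgebra K J) {e o : J} (he : e ∈ S.J0)
    (ho : o ∈ S.J1) : S.mul o e = S.mul e o := by
  simpa [sgn] using S.supercomm true false o ho e he

/-- The relation imposed by the super Jordan identity on the eigenvalues of left
multiplication by an even element `e` with `e² = αe`. -/
theorem eigenvalue_relation (S : JordanSuperalgebra K J) {e o : J} (he : e ∈ S.J0)
    (ho : o ∈ S.J1) (ho0 : o ≠ 0) {α β : K} (hee : S.mul e e = α • e)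
    (heo : S.mul e o = β • o) : β * ((α - β) * (α - 2 * β)) = 0 := by
  have hoe := (S.mul_comm_odd_even he ho).trans heo
  have h := S.superJordan false false false true e he e he e he o ho
  simp only [sgn, Bool.false_and, Bool.and_self, Bool.false_eq_true, if_false,
    mul_one, hee, heo, hoe, map_smul, LinearMap.smul_apply, smul_smul, ← add_smul] at h
  have := smul_left_injective K ho0 h
  linear_combination -this

/-- Rescaling the even generator rescales both structure constants. -/
theorem structure_constants_rescale (S : JordanSuperalgebra K J)
    (h0 : S.J0 ≠ ⊥) (h1 : S.J1 ≠ ⊥) {e o e' o' : J} {α β α' β' : K}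
    (he : S.J0 = Submodule.span K {e}) (ho : S.J1 = Submodule.span K {o})
    (he' : S.J0 = Submodule.span K {e'}) (ho' : S.J1 = Submodule.span K {o'})
    (hee : S.mul e e = α • e) (heo : S.mul e o = β • o)
    (hee' : S.mul e' e' = α' • e') (heo' : S.mul e' o' = β' • o') :
    ∃ c : K, c ≠ 0 ∧ α' = c * α ∧ β' = c * β := by
  have he_ne : e' ≠ 0 := by rintro rfl; simp [he'] at h0
  have ho_ne : o' ≠ 0 := by rintro rfl; simp [ho'] at h1
  obtain ⟨c, rfl⟩ := Submodule.mem_span_singleton.mp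
    (he.symm.trans he' ▸ Submodule.mem_span_singleton_self e' : e' ∈ Submodule.span K {e})
  obtain ⟨d, rfl⟩ := Submodule.mem_span_singleton.mp
    (ho.symm.trans ho' ▸ Submodule.mem_span_singleton_self o' : o' ∈ Submodule.span K {o})
  refine ⟨c, fun hc => he_ne (by simp [hc]), ?_, ?_⟩
  · apply smul_left_injective K he_ne
    simp only [← hee', map_smul, LinearMap.smul_apply, hee, smul_smul]
    congr 1
    ring
  · apply smul_left_injective K ho_ne
    simp only [← heo', map_smul, LinearMap.smul_apply, heo, smul_smul]
    congr 1
    ring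

end JordanSuperalgebra

/-- Classification of Jordan superalgebras of type `(1,1)` over an
algebraically closed field of characteristic ≠ 2: exactly one of four multiplication
tables `e₁² = ε·e₁`, `e₁o₁ = β·o₁` with `(ε, β) ∈ {(1,1), (1,1/2), (1,0), (0,0)}` is
realized by a homogeneous basis. -/
theorem classification_type_one_one (K : Type) [Field K] [IsAlgClosed K]
    (h2 : (2 : K) ≠ 0)
    (J : Type) [AddCommGroup J] [Module K J] (S : JordanSuperalgebra K J)
    (h0 : Module.finrank K S.J0 = 1) (h1 : Module.finrank K S.J1 = 1) :
    ∃! p : Fin 4, ∃ e o : J,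
      S.J0 = Submodule.span K {e} ∧ S.J1 = Submodule.span K {o} ∧
      S.mul e e = (![(1 : K), 1, 1, 0] p) • e ∧
      S.mul e o = (![(1 : K), 1/2, 0, 0] p) • o ∧
      S.mul o e = (![(1 : K), 1/2, 0, 0] p) • o ∧
      S.mul o o = 0 := by
  have b0 : S.J0 ≠ ⊥ := by
    intro h
    rw [h, finrank_bot] at h0
    exact zero_ne_one h0
  have b1 : S.J1 ≠ ⊥ := by
    intro h
    rw [h, finrank_bot] at h1
    exact zero_ne_one h1
  have exists_span (W : Submodule K J) (hW : Module.finrank K W = 1) :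
      ∃ v, v ≠ 0 ∧ W = Submodule.span K {v} := by
    obtain ⟨v, hv0, hv⟩ := finrank_eq_one_iff'.mp hW
    refine ⟨v, by simpa using hv0, le_antisymm (fun w hw => ?_) ?_⟩
    · obtain ⟨c, hc⟩ := hv ⟨w, hw⟩
      exact Submodule.mem_span_singleton.mpr ⟨c, congrArg Subtype.val hc⟩
    · simp
  obtain ⟨e, -, he⟩ := exists_span S.J0 h0
  obtain ⟨o, ho0, ho⟩ := exists_span S.J1 h1
  have me : e ∈ S.J0 := he ▸ Submodule.mem_span_singleton_self e
  have mo : o ∈ S.J1 := ho ▸ Submodule.mem_span_singleton_self o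
  have hoo := S.mul_self_odd h2 mo
  obtain ⟨α, hα⟩ := Submodule.mem_span_singleton.mp
    (he.le (S.grade false false e me e me))
  obtain ⟨β, hβ⟩ := Submodule.mem_span_singleton.mp
    (ho.le (S.grade false true e me o mo))
  have rel := S.eigenvalue_relation me mo ho0 hα.symm hβ.symm
  have key (c : K) (hc : c ≠ 0) (p : Fin 4) (hp : ![(1 : K), 1, 1, 0] p = c * α)
      (hq : ![(1 : K), 1/2, 0, 0] p = c * β) : ∃ e o : J,
      S.J0 = Submodule.span K {e} ∧ S.J1 = Submodule.span K {o} ∧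
      S.mul e e = (![(1 : K), 1, 1, 0] p) • e ∧
      S.mul e o = (![(1 : K), 1/2, 0, 0] p) • o ∧
      S.mul o e = (![(1 : K), 1/2, 0, 0] p) • o ∧
      S.mul o o = 0 := by
    refine ⟨c • e, o, ?_, ho, ?_, ?_, ?_, hoo⟩
    · rw [he, Submodule.span_singleton_smul_eq (IsUnit.mk0 c hc)]
    · rw [hp]
      simp only [map_smul, LinearMap.smul_apply, ← hα, smul_smul]
      congr 1
      ring
    · rw [hq, map_smul, LinearMap.smul_apply, ← hβ, smul_smul]
    · rw [hq, map_smul, S.mul_comm_odd_even me mo, ← hβ, smul_smul]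
  refine existsUnique_of_exists_of_unique ?_ ?_
  · by_cases hα0 : α = 0
    · have hβ0 : β = 0 := by simpa [hα0, h2] using rel
      exact ⟨3, key 1 one_ne_zero 3 (by simp [hα0]) (by simp [hβ0])⟩
    · have hα' : α⁻¹ ≠ 0 := inv_ne_zero hα0
      rcases mul_eq_zero.mp rel with h | h
      · exact ⟨2, key α⁻¹ hα' 2 (by simp [hα0]) (by simp [h])⟩
      rcases mul_eq_zero.mp h with h | h
      · rw [sub_eq_zero] at h
        exact ⟨0, key α⁻¹ hα' 0 (by simp [hα0]) (by simp [← h, hα0])⟩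
      · refine ⟨1, key α⁻¹ hα' 1 (by simp [hα0]) ?_⟩
        change 1 / 2 = α⁻¹ * β
        field_simp
        linear_combination h
  · rintro p q ⟨e, o, he, ho, hee, heo, -, -⟩ ⟨e', o', he', ho', hee', heo', -, -⟩
    obtain ⟨c, hc, h, h'⟩ :=
      S.structure_constants_rescale b0 b1 he ho he' ho' hee heo hee' heo'
    have half : (2 : K)⁻¹ ≠ 1 := by
      intro hh
      have := mul_inv_cancel₀ h2
      rw [hh] at this
      exact one_ne_zero (by linear_combination this : (1 : K) = 0)
    clear hee heo hee' heo' key rel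
    fin_cases p <;> fin_cases q <;> simp_all [eq_comm]
end

section
/- Let k be an algebraically closed field of characteristic ≠ 2 and let J be a Jordan superalgebra over k with dim J₀ = 1, dim J₁ = 2, such that the generator of J₀ squares to zero (J₀ is the nil algebra U₂). Then J is isomorphic, as a ℤ/2-graded algebra, to exactly one of the following four superalgebras on a basis {e₁; o₁, o₂} with e₁ even and o₁, o₂ odd (unlisted products zero, odd products determined by super-anticommutativity): (i) S₁³: e₁o₁ = o₂, o₁o₂ = e₁; (ii) S₂³: o₁o₂ = e₁; (iii) S₃³: e₁o₁ = o₂; (iv) all products zero. -/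
namespace JordanSuperalgebra

variable {K : Type*} [Field K] {J : Type*} [AddCommGroup J] [Module K J]

/-- `S` has a homogeneous basis `{f; w₁, w₂}` whose only nonzero products are
`f w₁ = w₁ f = α w₂` and `w₁ w₂ = - w₂ w₁ = β f`. -/
def HasTable (S : JordanSuperalgebra K J) (α β : K) : Prop :=
  ∃ f w₁ w₂ : J,
    S.J0 = Submodule.span K {f} ∧ f ≠ 0 ∧
    S.J1 = Submodule.span K {w₁, w₂} ∧ LinearIndependent K ![w₁, w₂] ∧
    S.mul f f = 0 ∧
    S.mul f w₁ = α • w₂ ∧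
    S.mul w₁ f = α • w₂ ∧
    S.mul f w₂ = 0 ∧ S.mul w₂ f = 0 ∧
    S.mul w₁ w₂ = β • f ∧
    S.mul w₂ w₁ = -(β • f) ∧
    S.mul w₁ w₁ = 0 ∧ S.mul w₂ w₂ = 0

variable {S : JordanSuperalgebra K J}

lemma mul_mem_odd {a b : J} (ha : a ∈ S.J0) (hb : b ∈ S.J1) : S.mul a b ∈ S.J1 :=
  S.grade false true a ha b hb

lemma mul_mem_even {a b : J} (ha : a ∈ S.J1) (hb : b ∈ S.J1) : S.mul a b ∈ S.J0 :=
  S.grade true true a ha b hb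

lemma odd_mul_even {a b : J} (ha : a ∈ S.J1) (hb : b ∈ S.J0) : S.mul a b = S.mul b a := by
  simpa [sgn] using S.supercomm true false a ha b hb

lemma odd_mul_odd {a b : J} (ha : a ∈ S.J1) (hb : b ∈ S.J1) : S.mul a b = -S.mul b a := by
  simpa [sgn] using S.supercomm true true a ha b hb

lemma odd_mul_self (h2 : (2 : K) ≠ 0) {a : J} (ha : a ∈ S.J1) : S.mul a a = 0 := by
  have h : (2 : K) • S.mul a a = 0 := by
    rw [two_smul]
    exact add_eq_zero_iff_eq_neg.mpr (odd_mul_odd ha ha)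
  exact (smul_eq_zero.mp h).resolve_left h2

/-- Left multiplication by an even element of square zero is nilpotent on the odd part. -/
lemma mul_mul_mul_eq_zero (h2 : (2 : K) ≠ 0) {e x : J} (he : e ∈ S.J0)
    (hsq : S.mul e e = 0) (hx : x ∈ S.J1) : S.mul e (S.mul e (S.mul e x)) = 0 := by
  have h := S.superJordan false false false true e he e he e he x hx
  have h1 := mul_mem_odd he hx
  have h3 := mul_mem_odd he h1
  simp only [sgn, hsq, odd_mul_even h1 he, odd_mul_even h3 he] at h
  simp only [map_zero, LinearMap.zero_apply, Bool.and_true, Bool.and_false,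
    Bool.false_eq_true, if_false, one_smul, mul_one, smul_zero, add_zero, zero_add] at h
  rw [← two_smul K] at h
  exact (smul_eq_zero.mp h.symm).resolve_left h2

lemma HasTable.of_linearIndependent (h2 : (2 : K) ≠ 0) (h1 : Module.finrank K S.J1 = 2)
    {f w₁ w₂ : J} {α β : K} (hJ0 : S.J0 = Submodule.span K {f}) (hf : f ≠ 0)
    (hw₁ : w₁ ∈ S.J1) (hw₂ : w₂ ∈ S.J1) (hli : LinearIndependent K ![w₁, w₂])
    (hff : S.mul f f = 0) (hfw₁ : S.mul f w₁ = α • w₂) (hfw₂ : S.mul f w₂ = 0)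
    (hww : S.mul w₁ w₂ = β • f) : S.HasTable α β := by
  have hfm : f ∈ S.J0 := hJ0 ▸ Submodule.mem_span_singleton_self f
  have : FiniteDimensional K S.J1 := Module.finite_of_finrank_pos (by omega)
  refine ⟨f, w₁, w₂, hJ0, hf, ?_, hli, hff, hfw₁, (odd_mul_even hw₁ hfm).trans hfw₁, hfw₂,
    (odd_mul_even hw₂ hfm).trans hfw₂, hww, ?_, odd_mul_self h2 hw₁, odd_mul_self h2 hw₂⟩
  · symm
    apply Submodule.eq_of_le_of_finrank_eq
    · rw [Submodule.span_le]
      rintro _ (rfl | rfl)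
      exacts [hw₁, hw₂]
    · rw [h1, ← Matrix.range_cons_cons_empty, finrank_span_eq_card hli, Fintype.card_fin]
  · rw [odd_mul_odd hw₂ hw₁, hww]

lemma HasTable.even_mul_odd_eq_zero_iff {α β : K} (h : S.HasTable α β) :
    (∀ a ∈ S.J0, ∀ b ∈ S.J1, S.mul a b = 0) ↔ α = 0 := by
  obtain ⟨f, w₁, w₂, hJ0, -, hJ1, hli, -, hfw₁, -, hfw₂, -⟩ := h
  constructor
  · intro h
    have hz := h f (hJ0 ▸ Submodule.mem_span_singleton_self f) w₁
      (hJ1 ▸ Submodule.subset_span (by simp))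
    rw [hfw₁] at hz
    exact (smul_eq_zero.mp hz).resolve_right (hli.ne_zero 1)
  · rintro rfl a ha b hb
    rw [hJ0, Submodule.mem_span_singleton] at ha
    rw [hJ1, Submodule.mem_span_pair] at hb
    obtain ⟨r, rfl⟩ := ha
    obtain ⟨s, t, rfl⟩ := hb
    simp [hfw₁, hfw₂]

lemma HasTable.odd_mul_odd_eq_zero_iff {α β : K} (h : S.HasTable α β) :
    (∀ a ∈ S.J1, ∀ b ∈ S.J1, S.mul a b = 0) ↔ β = 0 := by
  obtain ⟨f, w₁, w₂, -, hf, hJ1, -, -, -, -, -, -, h12, h21, h11, h22⟩ := h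
  constructor
  · intro h
    have hz := h w₁ (hJ1 ▸ Submodule.subset_span (by simp)) w₂
      (hJ1 ▸ Submodule.subset_span (by simp))
    rw [h12] at hz
    exact (smul_eq_zero.mp hz).resolve_right hf
  · rintro rfl a ha b hb
    rw [hJ1, Submodule.mem_span_pair] at ha hb
    obtain ⟨r, q, rfl⟩ := ha
    obtain ⟨s, t, rfl⟩ := hb
    simp [h12, h21, h11, h22]

/-- If the square-zero generator `e` of the even part acts nontrivially on the odd part,
some odd `y` satisfies `e y ≠ 0 = e (e y)`. -/
lemma exists_mul_ne_zero_mul_mul_eq_zero (h2 : (2 : K) ≠ 0) {e x : J} (he : e ∈ S.J0)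
    (hsq : S.mul e e = 0) (hx : x ∈ S.J1) (hex : S.mul e x ≠ 0) :
    ∃ y ∈ S.J1, S.mul e y ≠ 0 ∧ S.mul e (S.mul e y) = 0 := by
  by_cases h : S.mul e (S.mul e x) = 0
  · exact ⟨x, hx, hex, h⟩
  · exact ⟨S.mul e x, mul_mem_odd he hx, h, mul_mul_mul_eq_zero h2 he hsq hx⟩

lemma linearIndependent_pair_mul {e y : J} (hy : S.mul e y ≠ 0)
    (hy2 : S.mul e (S.mul e y) = 0) : LinearIndependent K ![y, S.mul e y] := by
  rw [LinearIndependent.pair_iff]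
  intro s t h
  have h' := congrArg (S.mul e) h
  simp only [map_add, map_smul, hy2, smul_zero, add_zero, map_zero] at h'
  have hs := (smul_eq_zero.mp h').resolve_right hy
  rw [hs, zero_smul, zero_add] at h
  exact ⟨hs, (smul_eq_zero.mp h).resolve_right hy⟩

lemma exists_hasTable_of_mul_ne_zero [IsAlgClosed K] (h2 : (2 : K) ≠ 0) {e y : J}
    (hJ0 : S.J0 = Submodule.span K {e}) (hne : e ≠ 0) (hsq : S.mul e e = 0)
    (h1 : Module.finrank K S.J1 = 2) (hym : y ∈ S.J1) (hy : S.mul e y ≠ 0)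
    (hy2 : S.mul e (S.mul e y) = 0) : S.HasTable 1 1 ∨ S.HasTable 1 0 := by
  have he : e ∈ S.J0 := hJ0 ▸ Submodule.mem_span_singleton_self e
  have hc := mul_mem_even hym (mul_mem_odd he hym)
  rw [hJ0, Submodule.mem_span_singleton] at hc
  obtain ⟨c, hc⟩ := hc
  by_cases h0 : c = 0
  · right
    refine .of_linearIndependent h2 h1 hJ0 hne hym (mul_mem_odd he hym)
      (linearIndependent_pair_mul hy hy2) hsq (one_smul K _).symm hy2 ?_
    rw [← hc, h0]
  · left
    obtain ⟨s, hs⟩ := IsAlgClosed.exists_pow_nat_eq c⁻¹ two_pos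
    have hs0 : s ≠ 0 := by
      rintro rfl
      exact inv_ne_zero h0 (by simpa using hs.symm)
    refine .of_linearIndependent h2 h1 hJ0 hne (S.J1.smul_mem s hym)
      (mul_mem_odd he (S.J1.smul_mem s hym))
      (linearIndependent_pair_mul ?_ ?_) hsq (one_smul K _).symm ?_ ?_
    · simpa [hs0] using hy
    · simp [hy2]
    · simp [hy2]
    · simp only [map_smul, LinearMap.smul_apply, ← hc, smul_smul]
      rw [← mul_assoc, ← sq, hs, inv_mul_cancel₀ h0]

lemma exists_hasTable_of_mul_eq_zero (h2 : (2 : K) ≠ 0) {e : J}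
    (hJ0 : S.J0 = Submodule.span K {e}) (hne : e ≠ 0) (hsq : S.mul e e = 0)
    (h1 : Module.finrank K S.J1 = 2) (hz : ∀ x ∈ S.J1, S.mul e x = 0) :
    S.HasTable 0 1 ∨ S.HasTable 0 0 := by
  have : FiniteDimensional K S.J1 := Module.finite_of_finrank_pos (by omega)
  let b := Module.finBasisOfFinrankEq K S.J1 h1
  have hli : LinearIndependent K ![(b 0 : J), (b 1 : J)] := by
    have h := b.linearIndependent.map' S.J1.subtype S.J1.ker_subtype
    have hb : S.J1.subtype ∘ b = ![(b 0 : J), (b 1 : J)] := by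
      ext i
      fin_cases i <;> rfl
    rwa [hb] at h
  have hc := mul_mem_even (b 0).2 (b 1).2
  rw [hJ0, Submodule.mem_span_singleton] at hc
  obtain ⟨c, hc⟩ := hc
  by_cases h0 : c = 0
  · right
    refine .of_linearIndependent h2 h1 hJ0 hne (b 0).2 (b 1).2 hli hsq ?_ (hz _ (b 1).2) ?_
    · rw [hz _ (b 0).2, zero_smul]
    · rw [← hc, h0]
  · left
    refine .of_linearIndependent (f := c • e) h2 h1 ?_ (smul_ne_zero h0 hne) (b 0).2 (b 1).2
      hli ?_ ?_ ?_ ?_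
    · rw [hJ0, Submodule.span_singleton_smul_eq (IsUnit.mk0 c h0)]
    · simp [hsq]
    · simp [hz _ (b 0).2]
    · simp [hz _ (b 1).2]
    · rw [one_smul, hc]

end JordanSuperalgebra

open JordanSuperalgebra

/-- Classification of Jordan superalgebras of type `(1,2)` whose even
part is the nil algebra `U₂` (so `e₁² = 0`), over an algebraically closed field of
characteristic ≠ 2: exactly one of the four tables `S₁³`, `S₂³`, `S₃³`, trivial is
realized by a homogeneous basis. -/
theorem classification_type_one_two_nil (K : Type) [Field K] [IsAlgClosed K]
    (h2 : (2 : K) ≠ 0)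
    (J : Type) [AddCommGroup J] [Module K J] (S : JordanSuperalgebra K J)
    (e : J) (hJ0 : S.J0 = Submodule.span K {e}) (hne : e ≠ 0)
    (hsq : S.mul e e = 0) (h1 : Module.finrank K S.J1 = 2) :
    ∃! p : Fin 4, ∃ f w₁ w₂ : J,
      S.J0 = Submodule.span K {f} ∧ f ≠ 0 ∧
      S.J1 = Submodule.span K {w₁, w₂} ∧ LinearIndependent K ![w₁, w₂] ∧
      S.mul f f = 0 ∧
      S.mul f w₁ = (![(1 : K), 0, 1, 0] p) • w₂ ∧
      S.mul w₁ f = (![(1 : K), 0, 1, 0] p) • w₂ ∧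
      S.mul f w₂ = 0 ∧ S.mul w₂ f = 0 ∧
      S.mul w₁ w₂ = (![(1 : K), 1, 0, 0] p) • f ∧
      S.mul w₂ w₁ = -((![(1 : K), 1, 0, 0] p) • f) ∧
      S.mul w₁ w₁ = 0 ∧ S.mul w₂ w₂ = 0 := by
  change ∃! p : Fin 4, S.HasTable (![(1 : K), 0, 1, 0] p) (![(1 : K), 1, 0, 0] p)
  refine existsUnique_of_exists_of_unique ?_ ?_
  · by_cases hz : ∀ x ∈ S.J1, S.mul e x = 0
    · rcases exists_hasTable_of_mul_eq_zero h2 hJ0 hne hsq h1 hz with h | h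
      exacts [⟨1, h⟩, ⟨3, h⟩]
    · push Not at hz
      obtain ⟨x, hx, hex⟩ := hz
      have he : e ∈ S.J0 := hJ0 ▸ Submodule.mem_span_singleton_self e
      obtain ⟨y, hym, hy, hy2⟩ := exists_mul_ne_zero_mul_mul_eq_zero h2 he hsq hx hex
      rcases exists_hasTable_of_mul_ne_zero h2 hJ0 hne hsq h1 hym hy hy2 with h | h
      exacts [⟨0, h⟩, ⟨2, h⟩]
  · intro p q hp hq
    have hα := hp.even_mul_odd_eq_zero_iff.symm.trans hq.even_mul_odd_eq_zero_iff
    have hβ := hp.odd_mul_odd_eq_zero_iff.symm.trans hq.odd_mul_odd_eq_zero_iff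
    clear hp hq
    fin_cases p <;> fin_cases q <;> simp at hα hβ ⊢
end

section
/- Let k be a field of characteristic ≠ 2 and let J be a Jordan superalgebra over k with dim J₀ = 2, dim J₁ = 1, such that J₀ has a basis {e₁, e₂} with e₁² = e₂ and e₁e₂ = e₂² = 0 (J₀ is the nilpotent Jordan algebra B₃). Then, writing J₁ = k·o₁, necessarily e₁o₁ = 0 and e₂o₁ = 0; that is, the only products in J are e₁² = e₂ (and this holds also when char k = 3). -/
/-- If `J` is a Jordan superalgebra of type `(2,1)` over a field of
characteristic ≠ 2 whose even part is the nilpotent Jordan algebra `B₃`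
(`e₁² = e₂`, `e₁e₂ = e₂² = 0`), then necessarily `e₁o₁ = 0` and `e₂o₁ = 0`
(also in characteristic 3). -/
theorem type_two_one_B3_trivial_action (K : Type) [Field K] (h2 : (2 : K) ≠ 0)
    (J : Type) [AddCommGroup J] [Module K J] (S : JordanSuperalgebra K J)
    (e₁ e₂ o₁ : J)
    (hJ0 : S.J0 = Submodule.span K {e₁, e₂}) (hli : LinearIndependent K ![e₁, e₂])
    (hJ1 : S.J1 = Submodule.span K {o₁}) (ho : o₁ ≠ 0)
    (h11 : S.mul e₁ e₁ = e₂) (h12 : S.mul e₁ e₂ = 0)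
    (h21 : S.mul e₂ e₁ = 0) (h22 : S.mul e₂ e₂ = 0) :
    S.mul e₁ o₁ = 0 ∧ S.mul e₂ o₁ = 0 := by
  have he₁ : e₁ ∈ S.J0 := hJ0 ▸ Submodule.subset_span (by simp)
  have he₂ : e₂ ∈ S.J0 := hJ0 ▸ Submodule.subset_span (by simp)
  have ho₁ : o₁ ∈ S.J1 := hJ1 ▸ Submodule.mem_span_singleton_self o₁
  have scalar : ∀ e ∈ S.J0, ∃ α : K, S.mul o₁ e = α • o₁ := fun e he => by
    have h : S.mul o₁ e ∈ S.J1 := S.grade true false o₁ ho₁ e he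
    rw [hJ1, Submodule.mem_span_singleton] at h
    exact h.imp fun _ h => h.symm
  have comm : ∀ e ∈ S.J0, S.mul e o₁ = S.mul o₁ e := fun e he => by
    simpa [sgn] using S.supercomm false true e he o₁ ho₁
  have cube_eq_zero : ∀ α : K, (0 : J) = (α * α * α) • o₁ + (α * α * α) • o₁ → α = 0 := by
    intro α h
    rw [← add_smul, ← two_mul] at h
    simpa [h2, ho] using h.symm
  obtain ⟨α, hα⟩ := scalar e₁ he₁
  obtain ⟨β, hβ⟩ := scalar e₂ he₂
  have hβ0 : β = 0 := cube_eq_zero β <| by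
    simpa [sgn, h22, hβ, smul_smul] using
      S.superJordan true false false false o₁ ho₁ e₂ he₂ e₂ he₂ e₂ he₂
  have hα0 : α = 0 := cube_eq_zero α <| by
    simpa [sgn, h11, h21, hα, hβ, hβ0, smul_smul] using
      S.superJordan true false false false o₁ ho₁ e₁ he₁ e₁ he₁ e₁ he₁
  rw [comm e₁ he₁, comm e₂ he₂, hα, hβ, hα0, hβ0]
  simp
end
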